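/- arXiv:0801.3472 — 3 statements merged into one kernel-verified Lean document; each statement's English description precedes it below -/
import Mathlib

section
/- Let R be a prime ring whose center C = Z(R) is a field and which is centrally closed in the sense that for any nonzero ideal I of R and any (R,R)-bimodule map f : I → R there exists c ∈ C with f(x) = cx for all x ∈ I. Let S be a C-algebra. Then every nonzero two-sided ideal J of R ⊗_C S contains a nonzero element of the form r ⊗ s with r ∈ R and s ∈ S. -/
open TensorProduct

/-- `f : R → R` restricts to an `(R,R)`-bimodule map on the two-sided ideal `I`. -/
def IsBimodOn {R : Type*} [Ring R] (I : TwoSidedIdeal R) (f : R → R) : Prop :=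
  (∀ x ∈ I, ∀ y ∈ I, f (x + y) = f x + f y) ∧
  (∀ r : R, ∀ x ∈ I, f (r * x) = r * f x) ∧
  (∀ r : R, ∀ x ∈ I, f (x * r) = f x * r)

/-- Let `R` be a prime ring whose center is (the image of) the field `C` and which is
centrally closed: every bimodule map on a nonzero ideal of `R` is multiplication by a
central scalar. Then for any `C`-algebra `S`, every nonzero two-sided ideal of
`R ⊗[C] S` contains a nonzero element of the form `r ⊗ s`. -/
theorem nonzero_simple_tensor_mem_of_centrally_closed
    {C R S : Type*} [Field C] [Ring R] [Algebra C R] [Ring S] [Algebra C S]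
    (hcenter : Set.range (algebraMap C R) = (Subring.center R : Set R))
    (hprime : ∀ A B : TwoSidedIdeal R, A ≠ ⊥ → B ≠ ⊥ → ∃ a ∈ A, ∃ b ∈ B, a * b ≠ 0)
    (hclosed : ∀ I : TwoSidedIdeal R, I ≠ ⊥ → ∀ f : R → R, IsBimodOn I f →
      ∃ c : C, ∀ x ∈ I, f x = algebraMap C R c * x) :
    ∀ J : TwoSidedIdeal (R ⊗[C] S), J ≠ ⊥ →
      ∃ (r : R) (s : S), r ⊗ₜ[C] s ∈ J ∧ r ⊗ₜ[C] s ≠ 0 := by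
  classical
  intro J hJ
  let b := Module.Basis.ofVectorSpace C S
  let B := Algebra.TensorProduct.basis R b
  have hl : ∀ (r : R) (y : R ⊗[C] S) i, B.repr (r ⊗ₜ 1 * y) i = r * B.repr y i := by
    intro r y i
    have : r ⊗ₜ[C] (1 : S) * y = r • y := by
      induction y using TensorProduct.induction_on with
      | zero => simp
      | tmul a s => simp [TensorProduct.smul_tmul']
      | add u v hu hv => rw [mul_add, hu, hv, smul_add]
    rw [this]; simp
  have hr : ∀ (r : R) (y : R ⊗[C] S) i, B.repr (y * r ⊗ₜ 1) i = B.repr y i * r := by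
    intro r y i
    induction y using TensorProduct.induction_on with
    | zero => simp
    | tmul a s =>
      simp only [Algebra.TensorProduct.tmul_mul_tmul, mul_one, B,
        Algebra.TensorProduct.basis_repr_tmul, Finsupp.smul_apply, Finsupp.mapRange_apply,
        smul_eq_mul, mul_assoc]
      congr 1
      exact (Algebra.commutes _ _).symm
    | add u v hu hv => simp only [add_mul, map_add, Finsupp.add_apply, hu, hv]
  have hex : ∃ n : ℕ, ∃ x ∈ J, x ≠ 0 ∧ (B.repr x).support.card = n := by
    by_contra! h
    apply hJ
    rw [eq_bot_iff]
    intro x hx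
    rw [TwoSidedIdeal.mem_bot]
    by_contra h0
    exact h _ x hx h0 rfl
  obtain ⟨x, hxJ, hx0, hxn⟩ := Nat.find_spec hex
  have hmin : ∀ y ∈ J, (B.repr y).support.card < (B.repr x).support.card → y = 0 := by
    intro y hy hlt
    by_contra h0
    rw [hxn] at hlt
    exact Nat.find_min hex hlt ⟨y, hy, h0, rfl⟩
  have hne : B.repr x ≠ 0 := by simpa using hx0
  obtain ⟨i0, hi0⟩ := Finsupp.ne_iff.1 hne
  simp only [Finsupp.coe_zero, Pi.zero_apply] at hi0
  let K : R ⊗[C] S → Prop := fun y => y ∈ J ∧ ∀ i, B.repr x i = 0 → B.repr y i = 0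
  have Kx : K x := ⟨hxJ, fun _ h => h⟩
  have K0 : K 0 := ⟨J.zero_mem, by simp⟩
  have Kadd : ∀ y z, K y → K z → K (y + z) := fun y z hy hz =>
    ⟨J.add_mem hy.1 hz.1, fun i hi => by simp [hy.2 i hi, hz.2 i hi]⟩
  have Kneg : ∀ y, K y → K (-y) := fun y hy =>
    ⟨J.neg_mem hy.1, fun i hi => by simp [hy.2 i hi]⟩
  have Kl : ∀ (r : R) y, K y → K (r ⊗ₜ 1 * y) := fun r y hy =>
    ⟨J.mul_mem_left _ _ hy.1, fun i hi => by rw [hl, hy.2 i hi, mul_zero]⟩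
  have Kr : ∀ (r : R) y, K y → K (y * r ⊗ₜ 1) := fun r y hy =>
    ⟨J.mul_mem_right _ _ hy.1, fun i hi => by rw [hr, hy.2 i hi, zero_mul]⟩
  have Kinj : ∀ y z, K y → K z → B.repr y i0 = B.repr z i0 → y = z := by
    intro y z hy hz h
    have hk := Kadd _ _ hy (Kneg _ hz)
    rw [← sub_eq_zero, sub_eq_add_neg]
    apply hmin _ hk.1
    apply Finset.card_lt_card
    rw [Finset.ssubset_iff_of_subset]
    · exact ⟨i0, by simpa using hi0, by simp [h]⟩
    · intro i hi
      rw [Finsupp.mem_support_iff] at hi ⊢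
      exact fun h' => hi (hk.2 i h')
  let I : TwoSidedIdeal R := TwoSidedIdeal.mk' {a | ∃ y, K y ∧ B.repr y i0 = a}
    ⟨0, K0, by simp⟩
    (by rintro _ _ ⟨y, hy, rfl⟩ ⟨z, hz, rfl⟩; exact ⟨y + z, Kadd _ _ hy hz, by simp⟩)
    (by rintro _ ⟨y, hy, rfl⟩; exact ⟨-y, Kneg _ hy, by simp⟩)
    (by rintro r _ ⟨y, hy, rfl⟩; exact ⟨_, Kl r _ hy, hl _ _ _⟩)
    (by rintro _ r ⟨y, hy, rfl⟩; exact ⟨_, Kr r _ hy, hr _ _ _⟩)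
  have hI : ∀ a, a ∈ I ↔ ∃ y, K y ∧ B.repr y i0 = a := by
    intro a
    simp only [I, TwoSidedIdeal.mem_mk']
    rfl
  have hIx : B.repr x i0 ∈ I := (hI _).2 ⟨x, Kx, rfl⟩
  have hIbot : I ≠ ⊥ := by
    intro h
    rw [h, TwoSidedIdeal.mem_bot] at hIx
    exact hi0 hIx
  have hc : ∀ i, ∃ c : C, B.repr x i = algebraMap C R c * B.repr x i0 := by
    intro i
    let f : R → R := fun a => if h : ∃ y, K y ∧ B.repr y i0 = a then B.repr h.choose i else 0
    have hf : ∀ y, K y → f (B.repr y i0) = B.repr y i := by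
      intro y hy
      have h : ∃ z, K z ∧ B.repr z i0 = B.repr y i0 := ⟨y, hy, rfl⟩
      simp only [f, dif_pos h]
      rw [Kinj _ _ h.choose_spec.1 hy h.choose_spec.2]
    obtain ⟨c, hc⟩ := hclosed I hIbot f (by
      refine ⟨?_, ?_, ?_⟩
      · intro a ha a' ha'
        obtain ⟨y, hy, rfl⟩ := (hI _).1 ha
        obtain ⟨z, hz, rfl⟩ := (hI _).1 ha'
        have := hf _ (Kadd _ _ hy hz)
        simp only [map_add, Finsupp.add_apply] at this
        rw [this, hf _ hy, hf _ hz]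
      · intro r a ha
        obtain ⟨y, hy, rfl⟩ := (hI _).1 ha
        have := hf _ (Kl r _ hy)
        rw [hl, hl] at this
        rw [this, hf _ hy]
      · intro r a ha
        obtain ⟨y, hy, rfl⟩ := (hI _).1 ha
        have := hf _ (Kr r _ hy)
        rw [hr, hr] at this
        rw [this, hf _ hy])
    exact ⟨c, by rw [← hc _ hIx, hf _ Kx]⟩
  choose c hc using hc
  have hx : x = B.repr x i0 ⊗ₜ[C] (∑ i ∈ (B.repr x).support, c i • b i) := by
    conv_lhs => rw [← B.linearCombination_repr x, Finsupp.linearCombination_apply, Finsupp.sum]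
    rw [TensorProduct.tmul_sum]
    refine Finset.sum_congr rfl fun i _ => ?_
    rw [hc i, Algebra.TensorProduct.basis_apply, TensorProduct.smul_tmul', smul_eq_mul, mul_one,
      ← Algebra.smul_def, TensorProduct.smul_tmul]
  exact ⟨_, _, hx ▸ hxJ, hx ▸ hx0⟩
end

section
/- Let V be a simple right module over a ring R with annihilator P = ann_R(V). Then there is an injective ring homomorphism from the extended centroid C(R/P) into the center of End_R(V), extending the canonical map Z(R/P) → Z(End_R(V)). -/
/-- `(Q, ι)` is a right Amitsur–Martindale ring of quotients of `R`: (i) `ι` is an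
embedding; (ii) every `q ∈ Q` multiplies some ideal of `R` with zero left annihilator
into `R`; (iii) elements of `Q` killing such an ideal are zero; (iv) every right
`R`-module map from such an ideal into `R` is realized by left multiplication by an
element of `Q`. These properties characterize `Q_r(R)` up to `R`-isomorphism. -/
structure IsMartindaleQuot {R Q : Type*} [Ring R] [Ring Q] (ι : R →+* Q) : Prop where
  inj : Function.Injective ι
  dom : ∀ q : Q, ∃ I : TwoSidedIdeal R,
    (∀ r : R, (∀ x ∈ I, r * x = 0) → r = 0) ∧ ∀ x ∈ I, ∃ r : R, q * ι x = ι r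
  ann : ∀ (q : Q) (I : TwoSidedIdeal R), (∀ r : R, (∀ x ∈ I, r * x = 0) → r = 0) →
    (∀ x ∈ I, q * ι x = 0) → q = 0
  lift : ∀ (I : TwoSidedIdeal R) (f : R → R),
    (∀ r : R, (∀ x ∈ I, r * x = 0) → r = 0) →
    (∀ x ∈ I, ∀ y ∈ I, f (x + y) = f x + f y) →
    (∀ x ∈ I, ∀ r : R, f (x * r) = f x * r) →
    ∃ q : Q, ∀ x ∈ I, q * ι x = ι (f x)

section Helpers

variable {R : Type*} [Ring R] {V : Type*} [AddCommGroup V] [Module R V]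
  {P : TwoSidedIdeal R} {Q : Type*} [Ring Q] (ι : P.ringCon.Quotient →+* Q)

/-- `w` is `q` times `v`. -/
def MRel (q : Q) (v w : V) : Prop :=
  ∀ x r : R, q * ι (P.ringCon.mk' x) = ι (P.ringCon.mk' r) → x • w = r • v

theorem mk_surj (x : P.ringCon.Quotient) : ∃ a : R, P.ringCon.mk' a = x :=
  Quotient.inductionOn' x fun a => ⟨a, rfl⟩

theorem mk_eq_iff (hP : ∀ r : R, r ∈ P ↔ ∀ v : V, r • v = 0) (a b : R) :
    P.ringCon.mk' a = P.ringCon.mk' b ↔ ∀ v : V, a • v = b • v := by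
  have h1 : P.ringCon.mk' a = P.ringCon.mk' b ↔ P.ringCon a b := P.ringCon.eq
  rw [h1, TwoSidedIdeal.rel_iff, hP]
  simp [sub_smul, sub_eq_zero]

variable {ι}

theorem kill (hsimple : IsSimpleModule R V)
    (hP : ∀ r : R, r ∈ P ↔ ∀ v : V, r • v = 0) (hQ : IsMartindaleQuot ι) (q : Q) (w : V)
    (h : ∀ x r : R, q * ι (P.ringCon.mk' x) = ι (P.ringCon.mk' r) → x • w = 0) : w = 0 := by
  by_contra hw
  obtain ⟨I, hI, hd⟩ := hQ.dom q
  have h1 : (1 : P.ringCon.Quotient) = 0 := by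
    apply hI
    intro x hx
    obtain ⟨a, rfl⟩ := mk_surj x
    rw [one_mul, ← map_zero P.ringCon.mk', mk_eq_iff hP]
    intro v
    obtain ⟨b, rfl⟩ := IsSimpleModule.toSpanSingleton_surjective R hw v
    obtain ⟨r, hr⟩ := hd _ (I.mul_mem_right _ (P.ringCon.mk' b) hx)
    obtain ⟨r, rfl⟩ := mk_surj r
    rw [← map_mul] at hr
    have := h _ _ hr
    simpa [mul_smul] using this
  rw [← map_one P.ringCon.mk', ← map_zero P.ringCon.mk', mk_eq_iff hP] at h1
  exact hw (by simpa using h1 w)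

theorem MRel.uniq (hsimple : IsSimpleModule R V)
    (hP : ∀ r : R, r ∈ P ↔ ∀ v : V, r • v = 0) (hQ : IsMartindaleQuot ι) {q : Q} {v w w' : V}
    (h : MRel ι q v w) (h' : MRel ι q v w') : w = w' := by
  rw [← sub_eq_zero]
  refine kill hsimple hP hQ q _ fun x r hx => ?_
  rw [smul_sub, h x r hx, h' x r hx, sub_self]

theorem MRel.add {q : Q} {v w v' w' : V}
    (h : MRel ι q v w) (h' : MRel ι q v' w') : MRel ι q (v + v') (w + w') := by
  intro x r hx
  rw [smul_add, smul_add, h x r hx, h' x r hx]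

theorem MRel.smul {q : Q} {v w : V} (s : R)
    (h : MRel ι q v w) : MRel ι q (s • v) (s • w) := by
  intro x r hx
  rw [← mul_smul, ← mul_smul]
  apply h
  rw [map_mul, map_mul, map_mul, map_mul, ← mul_assoc, hx]

theorem MRel.exists (hsimple : IsSimpleModule R V)
    (hP : ∀ r : R, r ∈ P ↔ ∀ v : V, r • v = 0) (hQ : IsMartindaleQuot ι) (q : Q)
    (hq : q ∈ Subring.center Q) (v : V) : ∃ w, MRel ι q v w := by
  let S : Submodule R V :=
    { carrier := {v | ∃ w, MRel ι q v w}
      zero_mem' := ⟨0, fun x r _ => by simp⟩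
      add_mem' := fun ⟨w, h⟩ ⟨w', h'⟩ => ⟨w + w', h.add h'⟩
      smul_mem' := fun s _ ⟨w, h⟩ => ⟨s • w, h.smul s⟩ }
  have key : ∀ (a b : R) (u : V), q * ι (P.ringCon.mk' a) = ι (P.ringCon.mk' b) →
      MRel ι q (a • u) (b • u) := by
    intro a b u hab x r hx
    rw [← mul_smul, ← mul_smul]
    refine (mk_eq_iff hP _ _).1 (hQ.inj ?_) u
    rw [map_mul, map_mul, map_mul, map_mul, ← hab, ← hx, ← mul_assoc,
      Subring.mem_center_iff.1 hq]
  rcases eq_bot_or_eq_top S with hS | hS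
  · have : v = 0 := kill hsimple hP hQ q v fun x r hx => by
      have : x • v ∈ S := ⟨_, key x r v hx⟩
      simpa [hS] using this
    exact ⟨0, by rw [this]; intro x r _; simp⟩
  · have : v ∈ S := by rw [hS]; trivial
    exact this

theorem MRel.mul (hsimple : IsSimpleModule R V)
    (hP : ∀ r : R, r ∈ P ↔ ∀ v : V, r • v = 0) (hQ : IsMartindaleQuot ι) {q q' : Q}
    (hq' : q' ∈ Subring.center Q) {v w w' w'' : V}
    (h' : MRel ι q' v w') (h : MRel ι q w' w) (h'' : MRel ι (q * q') v w'') : w'' = w := by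
  rw [← sub_eq_zero]
  refine kill hsimple hP hQ q' _ fun y s hy => kill hsimple hP hQ q _ fun x r hx => ?_
  have e1 : q * ι (P.ringCon.mk' (x * y)) = ι (P.ringCon.mk' (r * y)) := by
    simp only [map_mul, ← hx, mul_assoc]
  have e2 : q * q' * ι (P.ringCon.mk' (x * y)) = ι (P.ringCon.mk' (r * s)) := by
    simp only [map_mul, ← hx, ← hy]
    have := Subring.mem_center_iff.1 hq' (ι (P.ringCon.mk' x))
    simp only [mul_assoc]
    rw [← mul_assoc q', ← this, mul_assoc]
  rw [smul_sub, smul_sub, ← mul_smul, ← mul_smul, h'' _ _ e2, h _ _ e1, mul_smul, mul_smul,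
    h' _ _ hy, sub_self]

theorem MRel.add_left (hsimple : IsSimpleModule R V)
    (hP : ∀ r : R, r ∈ P ↔ ∀ v : V, r • v = 0) (hQ : IsMartindaleQuot ι) {q q' : Q}
    (hq' : q' ∈ Subring.center Q) {v w w' w'' : V}
    (h : MRel ι q v w) (h' : MRel ι q' v w') (h'' : MRel ι (q + q') v w'') :
    w'' = w + w' := by
  rw [← sub_eq_zero]
  refine kill hsimple hP hQ q' _ fun y s hy => kill hsimple hP hQ q _ fun x r hx => ?_
  have e1 : q * ι (P.ringCon.mk' (x * y)) = ι (P.ringCon.mk' (r * y)) := by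
    simp only [map_mul, ← hx, mul_assoc]
  have e2 : q' * ι (P.ringCon.mk' (x * y)) = ι (P.ringCon.mk' (x * s)) := by
    simp only [map_mul, ← hy]
    have := Subring.mem_center_iff.1 hq' (ι (P.ringCon.mk' x))
    rw [← mul_assoc q', ← this, mul_assoc]
  have e3 : (q + q') * ι (P.ringCon.mk' (x * y)) = ι (P.ringCon.mk' (r * y + x * s)) := by
    rw [add_mul, e1, e2, map_add, map_add]
  rw [← mul_smul, smul_sub, smul_add, h'' _ _ e3, h _ _ e1, h' _ _ e2, add_smul, sub_self]

end Helpers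


/-- Let `V` be a simple (left) module over a ring `R` with annihilator `P`, and let
`Q` be the Amitsur–Martindale quotient ring of `R/P`, so that the extended centroid
`C(R/P)` is the center of `Q`. Then there is an injective ring homomorphism
`C(R/P) → End_R(V)` landing in the center of `End_R(V)` and extending the canonical
map `Z(R/P) → Z(End_R(V))` given by the module action. -/
theorem extended_centroid_embeds_in_center_of_endomorphism_ring
    {R : Type*} [Ring R] (V : Type*) [AddCommGroup V] [Module R V]
    (hsimple : IsSimpleModule R V)
    (P : TwoSidedIdeal R) (hP : ∀ r : R, r ∈ P ↔ ∀ v : V, r • v = 0)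
    {Q : Type*} [Ring Q] (ι : P.ringCon.Quotient →+* Q)
    (hQ : IsMartindaleQuot ι) :
    ∃ φ : Subring.center Q →+* Module.End R V,
      Function.Injective φ ∧
      (∀ (q : Subring.center Q) (ψ : Module.End R V), φ q * ψ = ψ * φ q) ∧
      ∀ (r : R) (hr : ι (P.ringCon.mk' r) ∈ Subring.center Q) (v : V),
        φ ⟨ι (P.ringCon.mk' r), hr⟩ v = r • v := by
  choose f hf using fun (q : Subring.center Q) (v : V) =>
    MRel.exists hsimple hP hQ q.1 q.2 v
  have uq : ∀ (q : Subring.center Q) (v w : V), MRel ι q.1 v w → f q v = w :=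
    fun q v w h => (hf q v).uniq hsimple hP hQ h
  let g : Subring.center Q → Module.End R V := fun q =>
    { toFun := f q
      map_add' := fun v v' => uq _ _ _ ((hf q v).add (hf q v'))
      map_smul' := fun s v => uq _ _ _ ((hf q v).smul s) }
  let φ : Subring.center Q →+* Module.End R V :=
    { toFun := g
      map_one' := by
        ext v
        refine uq _ _ _ fun x r h => ?_
        simp only [OneMemClass.coe_one, one_mul] at h
        exact (mk_eq_iff hP _ _).1 (hQ.inj h) v
      map_zero' := by
        ext v
        refine uq _ _ _ fun x r h => ?_
        simp only [ZeroMemClass.coe_zero, zero_mul] at h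
        have h2 : P.ringCon.mk' 0 = P.ringCon.mk' r := hQ.inj (by simpa using h)
        simpa using (mk_eq_iff hP _ _).1 h2 v
      map_mul' := fun q q' => by
        ext v
        exact MRel.mul hsimple hP hQ q'.2 (hf q' v) (hf q _) (hf (q * q') v)
      map_add' := fun q q' => by
        ext v
        exact MRel.add_left hsimple hP hQ q'.2 (hf q v) (hf q' v) (hf (q + q') v) }
  refine ⟨φ, ?_, ?_, ?_⟩
  · rw [injective_iff_map_eq_zero]
    intro q hq
    have h0 : ∀ v, f q v = 0 := fun v => LinearMap.congr_fun hq v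
    obtain ⟨I, hI, hd⟩ := hQ.dom q.1
    apply Subtype.ext
    refine hQ.ann q.1 I hI fun x hx => ?_
    obtain ⟨r, hr⟩ := hd x hx
    obtain ⟨x, rfl⟩ := mk_surj x
    obtain ⟨r, rfl⟩ := mk_surj r
    have : P.ringCon.mk' r = P.ringCon.mk' 0 := (mk_eq_iff hP _ _).2 fun v => by
      rw [← hf q v x r hr, h0, smul_zero, zero_smul]
    rw [hr, this, map_zero, map_zero]
  · intro q ψ
    ext v
    refine uq _ _ _ fun x r h => ?_
    change x • ψ (f q v) = r • ψ v
    rw [← map_smul, ← map_smul, hf q v x r h]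
  · intro r hr v
    refine uq _ _ _ fun x s h => ?_
    rw [← mul_smul]
    refine (mk_eq_iff hP _ _).1 (hQ.inj ?_) v
    rw [← h, map_mul, map_mul]
    exact Subring.mem_center_iff.1 hr _
end

section
/- Let G be a connected affine algebraic group over an algebraically closed field k that acts rationally by k-algebra automorphisms on a field extension F of k. Then the G-action on F is trivial. -/
open TensorProduct

lemma aux_alg {F R ι : Type*} [Field F] [CommRing R] [Algebra F R] [Algebra.FiniteType F R]
    [Infinite ι] (c : ι → F) (hc : Function.Injective c) (u : R)
    (hu : ∀ i, IsUnit (u - algebraMap F R (c i))) : IsAlgebraic F u := by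
  by_contra htr
  have hinj : Function.Injective (Polynomial.aeval (R := F) u) :=
    transcendental_iff_injective.mp htr
  set f : Polynomial F →+* R := (Polynomial.aeval (R := F) u).toRingHom with hf
  have hft : f.FiniteType := by
    have h1 : (f.comp (algebraMap F (Polynomial F))).FiniteType := by
      have : f.comp (algebraMap F (Polynomial F)) = algebraMap F R := by
        ext x; simp [hf]
      rw [this]
      exact RingHom.finiteType_algebraMap.mpr inferInstance
    exact RingHom.FiniteType.of_comp_finiteType h1
  have hfp : f.FinitePresentation := RingHom.FinitePresentation.of_finiteType.mp hft
  have hcons := PrimeSpectrum.isConstructible_range_comap hfp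
  obtain ⟨S, hS⟩ := PrimeSpectrum.exists_constructibleSetData_iff.mpr hcons
  have hbot : (⊥ : PrimeSpectrum (Polynomial F)) ∈ Set.range (PrimeSpectrum.comap f) := by
    obtain ⟨p, hp, hp'⟩ := Ideal.exists_comap_eq_of_mem_minimalPrimes_of_injective
      (f := f) hinj (⊥ : Ideal (Polynomial F)) (by simp [IsDomain.minimalPrimes_eq_singleton_bot])
    exact ⟨⟨p, hp⟩, PrimeSpectrum.ext hp'⟩
  rw [← hS] at hbot
  simp only [PrimeSpectrum.ConstructibleSetData.toSet, Set.mem_iUnion] at hbot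
  obtain ⟨C, hC, h1, h2⟩ := hbot
  have hC0 : C.f ≠ 0 := by
    simpa [PrimeSpectrum.mem_zeroLocus] using h2
  have hg0 : ∀ i, C.g i = 0 := by
    intro i
    have := h1 (Set.mem_range_self i)
    simpa using this
  obtain ⟨i, hi⟩ : ∃ i, C.f.eval (c i) ≠ 0 := by
    by_contra! hall
    exact hC0 (Polynomial.eq_zero_of_infinite_isRoot _
      ((Set.infinite_range_of_injective hc).mono (by rintro _ ⟨i, rfl⟩; exact hall i)))
  let P : PrimeSpectrum (Polynomial F) :=
    ⟨RingHom.ker (Polynomial.evalRingHom (c i)), RingHom.ker_isPrime _⟩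
  have hP : P ∈ S.toSet := by
    simp only [PrimeSpectrum.ConstructibleSetData.toSet, Set.mem_iUnion]
    refine ⟨C, hC, ?_, ?_⟩
    · rintro _ ⟨j, rfl⟩
      simp [hg0 j]
    · intro h
      apply hi
      simpa [P, PrimeSpectrum.mem_zeroLocus, RingHom.mem_ker] using h
  rw [hS] at hP
  obtain ⟨q, hq⟩ := hP
  have hmem : (Polynomial.X - Polynomial.C (c i)) ∈ P.asIdeal := by
    simp [P, RingHom.mem_ker]
  rw [← hq] at hmem
  have : u - algebraMap F R (c i) ∈ q.asIdeal := by
    simpa [hf] using hmem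
  exact q.2.ne_top (Ideal.eq_top_of_isUnit_mem _ this (hu i))

lemma aux_pt {k A : Type*} [Field k] [IsAlgClosed k] [CommRing A] [IsDomain A] [Algebra k A]
    [Algebra.FiniteType k A] (a : A) (ha : a ≠ 0) : ∃ φ : A →ₐ[k] k, φ a ≠ 0 := by
  let B := Localization.Away a
  have : Algebra.FiniteType A B := IsLocalization.finiteType_of_monoid_fg (Submonoid.powers a) B
  have : Algebra.FiniteType k B := Algebra.FiniteType.trans (S := A) inferInstance inferInstance
  have : Nontrivial B := (IsLocalization.injective B (M := Submonoid.powers a)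
    (powers_le_nonZeroDivisors_of_noZeroDivisors ha)).nontrivial
  obtain ⟨m, hm⟩ := Ideal.exists_maximal B
  letI : Field (B ⧸ m) := Ideal.Quotient.field m
  have : Module.Finite k (B ⧸ m) := finite_of_finite_type_of_isJacobsonRing k (B ⧸ m)
  let ψ : (B ⧸ m) →ₐ[k] k := IsAlgClosed.lift
  let φ : A →ₐ[k] k := (ψ.comp (Ideal.Quotient.mkₐ k m)).comp (IsScalarTower.toAlgHom k A B)
  refine ⟨φ, ?_⟩
  have h : IsUnit (algebraMap A B a) := IsLocalization.Away.algebraMap_isUnit a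
  exact (h.map (ψ.comp (Ideal.Quotient.mkₐ k m))).ne_zero

lemma aux_coeff {k A F : Type*} [Field k] [CommRing A] [Algebra k A] [Field F] [Algebra k F]
    (z : F ⊗[k] A) (hz : z ≠ 0) : ∃ a : A, a ≠ 0 ∧ ∀ φ : A →ₐ[k] k, φ a ≠ 0 →
      (TensorProduct.rid k F) (TensorProduct.map LinearMap.id φ.toLinearMap z) ≠ 0 := by
  classical
  let b := Module.Basis.ofVectorSpace k F
  let e := TensorProduct.equivFinsuppOfBasisLeft (N := A) b
  have hez : e z ≠ 0 := by simpa using hz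
  obtain ⟨i, hi⟩ := Finsupp.ne_iff.mp hez
  refine ⟨e z i, hi, fun φ hφ h0 => hφ ?_⟩
  have key : ∀ w : F ⊗[k] A, b.repr ((TensorProduct.rid k F)
      (TensorProduct.map LinearMap.id φ.toLinearMap w)) i = φ (e w i) := by
    intro w
    induction w with
    | zero => simp
    | add x y hx hy => simp only [map_add, Finsupp.add_apply, hx, hy]
    | tmul x y => simp [e, mul_comm]
  rw [← key, h0]; simp

/-- Let `G` be a connected affine algebraic group over an algebraically closed field
`k`, presented by its coordinate Hopf algebra `A = k[G]` (a finitely generated domain)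
with `k`-points identified via `pt`. If `G` acts rationally by `k`-algebra
automorphisms on a field `F` (an `A`-comodule algebra structure `ρ` recovering the
action by evaluation), then the `G`-action on `F` is trivial. -/
theorem rational_action_on_field_is_trivial
    {k : Type*} [Field k] [IsAlgClosed k]
    {A : Type*} [CommRing A] [IsDomain A] [HopfAlgebra k A] [Algebra.FiniteType k A]
    {G : Type*} [Group G] (pt : G ≃ (A →ₐ[k] k))
    (hpt : ∀ (g h : G) (a : A), pt (g * h) a =
      LinearMap.mul' k k
        (TensorProduct.map (pt g).toLinearMap (pt h).toLinearMap (Coalgebra.comul a)))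
    {F : Type*} [Field F] [Algebra k F] [MulSemiringAction G F]
    (ρ : F →ₐ[k] F ⊗[k] A)
    (hcounit : ∀ x : F, (TensorProduct.rid k F)
      (TensorProduct.map LinearMap.id (Bialgebra.counitAlgHom k A).toLinearMap (ρ x))
        = x)
    (haction : ∀ (g : G) (x : F), g • x =
      (TensorProduct.rid k F)
        (TensorProduct.map LinearMap.id (pt g).toLinearMap (ρ x))) :
    ∀ (g : G) (x : F), g • x = x := by
  intro g x
  let ev : (A →ₐ[k] k) → (F ⊗[k] A →ₐ[F] F) := fun φ =>
    (Algebra.TensorProduct.rid k F F).toAlgHom.comp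
      (Algebra.TensorProduct.map (AlgHom.id F F) φ)
  have hev : ∀ φ z, (TensorProduct.rid k F)
      (TensorProduct.map LinearMap.id φ.toLinearMap z) = ev φ z := by
    intro φ z
    induction z with
    | zero => simp
    | add x y hx hy => simp only [map_add, hx, hy]
    | tmul x y => simp [ev]
  simp only [hev] at haction hcounit
  by_cases hx : ∃ c : k, algebraMap k F c = x
  · obtain ⟨c, rfl⟩ := hx
    rw [haction, AlgHom.commutes, IsScalarTower.algebraMap_apply k F (F ⊗[k] A),
      AlgHom.commutes]
    rfl
  have halg : IsAlgebraic F (ρ x) := by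
    haveI : Infinite k := IsAlgClosed.instInfinite
    refine aux_alg (algebraMap k F) (algebraMap k F).injective (ρ x) fun c => ?_
    have h : IsUnit (x - algebraMap k F c) :=
      (sub_ne_zero.mpr fun h => hx ⟨c, h.symm⟩).isUnit
    have := h.map ρ
    rwa [map_sub, AlgHom.commutes, IsScalarTower.algebraMap_apply k F (F ⊗[k] A)] at this
  obtain ⟨P, hP0, hP⟩ := halg
  have hroot : ∀ φ, ev φ (ρ x) ∈ P.roots := by
    intro φ
    rw [Polynomial.mem_roots hP0, Polynomial.IsRoot.def, ← Polynomial.coe_aeval_eq_eval,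
      Polynomial.aeval_algHom_apply, hP, map_zero]
  obtain ⟨r, hr⟩ : ∃ r : F, ρ x = algebraMap F (F ⊗[k] A) r := by
    by_contra! hne
    choose a ha0 ha using fun r => aux_coeff _ (sub_ne_zero.mpr (hne r))
    classical
    obtain ⟨φ, hφ⟩ := aux_pt (k := k) (∏ r ∈ P.roots.toFinset, a r)
      (Finset.prod_ne_zero_iff.mpr fun r _ => ha0 r)
    rw [map_prod, Finset.prod_ne_zero_iff] at hφ
    have := ha _ φ (hφ (ev φ (ρ x)) (by simpa only [Multiset.mem_toFinset] using hroot φ))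
    rw [hev, map_sub, AlgHom.commutes] at this
    simp at this
  have h1 := hcounit x
  rw [hr, AlgHom.commutes] at h1
  rw [haction, hr, AlgHom.commutes]
  exact h1
end
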